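/- arXiv:0711.0642 — 7 statements merged into one kernel-verified Lean document; each statement's English description precedes it below -/
import Mathlib

section
/- Fix reals ρ_e > 0, e ∈ [0,1), h. Define N(φ) = ρ_e/√(1 − e²·sin²φ), M(φ) = ρ_e·(1−e²)/(1 − e²·sin²φ)^{3/2}, and r(λ,φ) = ((N(φ)+h)·cos φ·cos λ, (N(φ)+h)·cos φ·sin λ, (N(φ)·(1−e²)+h)·sin φ) ∈ ℝ³. Then for all λ and all φ with cos φ ≠ 0 and N(φ)+h ≠ 0, the mixed second partial derivative satisfies the vector identity ∂²r/∂φ∂λ = −( (M(φ)+h)·sin φ / ((N(φ)+h)·cos φ) ) · ∂r/∂λ. -/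
open Real

/-- The radius `(N + h) cos φ` of the parallel at latitude `φ` has derivative `-(M + h) sin φ`. -/
lemma hasDerivAt_parallel_radius (ρe e h φ : ℝ) (hW : 0 < 1 - e ^ 2 * Real.sin φ ^ 2) :
    HasDerivAt (fun p => (ρe / Real.sqrt (1 - e ^ 2 * Real.sin p ^ 2) + h) * Real.cos p)
      (-((ρe * (1 - e ^ 2) / (1 - e ^ 2 * Real.sin φ ^ 2) ^ ((3 : ℝ) / 2) + h) * Real.sin φ)) φ := by
  have hd : HasDerivAt (fun p => 1 - e ^ 2 * Real.sin p ^ 2)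
      (-(e ^ 2 * (2 * Real.sin φ * Real.cos φ))) φ := by
    simpa using (((Real.hasDerivAt_sin φ).pow 2).const_mul (e ^ 2)).const_sub 1
  have hpow : (1 - e ^ 2 * Real.sin φ ^ 2) ^ ((3 : ℝ) / 2) =
      Real.sqrt (1 - e ^ 2 * Real.sin φ ^ 2) ^ 3 := by
    rw [Real.sqrt_eq_rpow, ← Real.rpow_mul_natCast hW.le]
    norm_num
  have hs := Real.sqrt_pos.2 hW
  have hsq := Real.sq_sqrt hW.le
  refine ((((hasDerivAt_const φ ρe).div (hd.sqrt hW.ne') hs.ne').add_const h).mul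
    (Real.hasDerivAt_cos φ)).congr_deriv ?_
  rw [hpow]
  simp only [Pi.div_apply]
  generalize Real.sqrt (1 - e ^ 2 * Real.sin φ ^ 2) = w at hs hsq ⊢
  have hcos := Real.cos_sq' φ
  field_simp
  linear_combination -(Real.sin φ * ρe) * hsq + (Real.sin φ * ρe * e ^ 2) * hcos

/-- The mixed second partial derivative `∂²r/∂φ∂λ` is proportional to `∂r/∂λ`,
the proportionality factor being (minus) the Christoffel symbol `Γ^λ_{φλ}`
of the surface of constant altitude `h`. -/
theorem christoffel_lambda_phi_lambda_vector_identity
    (ρe e h : ℝ) (hρe : 0 < ρe) (he0 : 0 ≤ e) (he1 : e < 1)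
    (N M : ℝ → ℝ)
    (hN : ∀ φ : ℝ, N φ = ρe / Real.sqrt (1 - e ^ 2 * Real.sin φ ^ 2))
    (hM : ∀ φ : ℝ, M φ = ρe * (1 - e ^ 2) / (1 - e ^ 2 * Real.sin φ ^ 2) ^ ((3 : ℝ) / 2))
    (r : ℝ → ℝ → EuclideanSpace ℝ (Fin 3))
    (hr : ∀ lam φ : ℝ, r lam φ =
      ![(N φ + h) * Real.cos φ * Real.cos lam,
        (N φ + h) * Real.cos φ * Real.sin lam,
        (N φ * (1 - e ^ 2) + h) * Real.sin φ])
    (lam φ : ℝ) (hcos : Real.cos φ ≠ 0) (hNh : N φ + h ≠ 0) :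
    deriv (fun p => deriv (fun l => r l p) lam) φ =
      (-((M φ + h) * Real.sin φ / ((N φ + h) * Real.cos φ))) •
        deriv (fun l => r l φ) lam := by
  have hW (p : ℝ) : 0 < 1 - e ^ 2 * Real.sin p ^ 2 := by
    nlinarith [Real.sin_sq_le_one p, sq_nonneg e]
  set b : Fin 3 → EuclideanSpace ℝ (Fin 3) := fun i => EuclideanSpace.single i 1 with hb
  have hr' (l p : ℝ) : r l p =
      ((N p + h) * Real.cos p) • (Real.cos l • b 0 + Real.sin l • b 1) +
        ((N p * (1 - e ^ 2) + h) * Real.sin p) • b 2 := by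
    ext i
    rw [hr]
    fin_cases i <;> simp [hb]
  have hl (p : ℝ) : deriv (fun l => r l p) lam =
      ((N p + h) * Real.cos p) • (-Real.sin lam • b 0 + Real.cos lam • b 1) := by
    simp only [hr']
    exact (((((Real.hasDerivAt_cos lam).smul_const (b 0)).add
      ((Real.hasDerivAt_sin lam).smul_const (b 1))).const_smul
        ((N p + h) * Real.cos p)).add_const _).deriv
  have hφ : HasDerivAt (fun p => (N p + h) * Real.cos p) (-((M φ + h) * Real.sin φ)) φ := by
    simp only [hN, hM]
    exact hasDerivAt_parallel_radius ρe e h φ (hW φ)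
  simp only [hl]
  rw [(hφ.smul_const _).deriv, smul_smul, neg_mul, div_mul_cancel₀ _ (mul_ne_zero hNh hcos)]
end

section
/- Fix reals ρ_e > 0, e ∈ [0,1), h. Define N(φ) = ρ_e/√(1 − e²·sin²φ), M(φ) = ρ_e·(1−e²)/(1 − e²·sin²φ)^{3/2}, and r(λ,φ) = ((N(φ)+h)·cos φ·cos λ, (N(φ)+h)·cos φ·sin λ, (N(φ)·(1−e²)+h)·sin φ) ∈ ℝ³. Then for all λ, φ, ⟨∂²r/∂φ², ∂r/∂φ⟩ = 3·N(φ)·e²·(1−e²)·(M(φ)+h)·sin φ·cos φ / (1 − e²·sin²φ)². -/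
open Real
open scoped RealInnerProductSpace

lemma geodetic_denominator_pos {e : ℝ} (he0 : 0 ≤ e) (he1 : e < 1) (p : ℝ) :
    0 < 1 - e ^ 2 * sin p ^ 2 := by
  nlinarith [sin_sq_le_one p, sq_nonneg e, mul_nonneg (sq_nonneg e) (sub_nonneg.2 (sin_sq_le_one p))]

lemma rpow_three_halves {w : ℝ} (hw : 0 ≤ w) : w ^ ((3 : ℝ) / 2) = √w ^ 3 := by
  rw [sqrt_eq_rpow, ← rpow_natCast, ← rpow_mul hw]
  norm_num

lemma hasDerivAt_sqrt_geodetic_denominator {e p : ℝ} (hw : 0 < 1 - e ^ 2 * sin p ^ 2) :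
    HasDerivAt (fun x => √(1 - e ^ 2 * sin x ^ 2))
      (-(e ^ 2 * sin p * cos p) / √(1 - e ^ 2 * sin p ^ 2)) p := by
  have h1 := ((((hasDerivAt_sin p).pow 2).const_mul (e ^ 2)).const_sub 1).sqrt hw.ne'
  refine h1.congr_deriv ?_
  have := (sqrt_pos.2 hw).ne'
  simp only [Pi.pow_apply]
  field_simp
  norm_num
  ring

lemma EuclideanSpace.hasDerivAt_of_apply {ι : Type*} [Fintype ι] {f : ℝ → EuclideanSpace ℝ ι}
    {f' : EuclideanSpace ℝ ι} {x : ℝ} (hf : ∀ i, HasDerivAt (fun t => f t i) (f' i) x) :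
    HasDerivAt f f' x := by
  rw [hasDerivAt_iff_hasFDerivAt, ← hasFDerivWithinAt_univ, hasFDerivWithinAt_euclidean]
  intro i
  rw [hasFDerivWithinAt_univ]
  refine (hf i).hasFDerivAt.congr_fderiv ?_
  ext
  simp

/-- The inner product `⟨∂²r/∂φ², ∂r/∂φ⟩` equals
`3·N·e²·(1−e²)·(M+h)·sin φ·cos φ/(1 − e²·sin²φ)²`, which divided by
`G = (M+h)²` gives the Christoffel symbol `Γ^φ_{φφ}`. -/
theorem christoffel_phi_phi_phi_inner_product
    (ρe e h : ℝ) (hρe : 0 < ρe) (he0 : 0 ≤ e) (he1 : e < 1)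
    (N M : ℝ → ℝ)
    (hN : ∀ φ : ℝ, N φ = ρe / Real.sqrt (1 - e ^ 2 * Real.sin φ ^ 2))
    (hM : ∀ φ : ℝ, M φ = ρe * (1 - e ^ 2) / (1 - e ^ 2 * Real.sin φ ^ 2) ^ ((3 : ℝ) / 2))
    (r : ℝ → ℝ → EuclideanSpace ℝ (Fin 3))
    (hr : ∀ lam φ : ℝ, r lam φ =
      ![(N φ + h) * Real.cos φ * Real.cos lam,
        (N φ + h) * Real.cos φ * Real.sin lam,
        (N φ * (1 - e ^ 2) + h) * Real.sin φ])
    (lam φ : ℝ) :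
    ⟪deriv (deriv (fun p => r lam p)) φ, deriv (fun p => r lam p) φ⟫ =
      3 * N φ * e ^ 2 * (1 - e ^ 2) * (M φ + h) * Real.sin φ * Real.cos φ /
        (1 - e ^ 2 * Real.sin φ ^ 2) ^ 2 := by
  have hw := geodetic_denominator_pos he0 he1
  have hq (p : ℝ) : 0 < √(1 - e ^ 2 * sin p ^ 2) := sqrt_pos.2 (hw p)
  have hq2 (p : ℝ) : √(1 - e ^ 2 * sin p ^ 2) ^ 2 = 1 - e ^ 2 * sin p ^ 2 := sq_sqrt (hw p).le
  have hM' (p : ℝ) : M p = ρe * (1 - e ^ 2) / √(1 - e ^ 2 * sin p ^ 2) ^ 3 := by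
    rw [hM, rpow_three_halves (hw p).le]
  have hdN (p : ℝ) : HasDerivAt N
      (ρe * (e ^ 2 * sin p * cos p) / √(1 - e ^ 2 * sin p ^ 2) ^ 3) p := by
    rw [funext hN]
    refine ((hasDerivAt_const p ρe).div
      (hasDerivAt_sqrt_geodetic_denominator (hw p)) (hq p).ne').congr_deriv ?_
    have := (hq p).ne'
    field_simp
    ring
  have hdM (p : ℝ) : HasDerivAt M
      (3 * N p * e ^ 2 * (1 - e ^ 2) * sin p * cos p / (1 - e ^ 2 * sin p ^ 2) ^ 2) p := by
    rw [funext hM', hN]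
    refine ((hasDerivAt_const p (ρe * (1 - e ^ 2))).div
      ((hasDerivAt_sqrt_geodetic_denominator (hw p)).pow 3)
      (pow_ne_zero 3 (hq p).ne')).congr_deriv ?_
    simp only [Pi.pow_apply]
    have hqp := (hq p).ne'
    have hqp2 := hq2 p
    generalize √(1 - e ^ 2 * sin p ^ 2) = q at hqp hqp2 ⊢
    rw [← hqp2]
    field_simp
    norm_num
    ring
  have hparallel (p : ℝ) : HasDerivAt (fun x => (N x + h) * cos x) (-((M p + h) * sin p)) p := by
    refine (((hdN p).add_const h).mul (hasDerivAt_cos p)).congr_deriv ?_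
    have := (hq p).ne'
    rw [hM', hN]
    field_simp
    linear_combination (ρe * sin p * e ^ 2) * sin_sq_add_cos_sq p - ρe * sin p * hq2 p
  have haxial (p : ℝ) :
      HasDerivAt (fun x => (N x * (1 - e ^ 2) + h) * sin x) ((M p + h) * cos p) p := by
    refine ((((hdN p).mul_const (1 - e ^ 2)).add_const h).mul (hasDerivAt_sin p)).congr_deriv ?_
    have := (hq p).ne'
    rw [hM', hN]
    field_simp
    linear_combination ρe * (1 - e ^ 2) * cos p * hq2 p
  have hr1 (p : ℝ) : HasDerivAt (fun p => r lam p)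
      !₂[-((M p + h) * sin p) * cos lam, -((M p + h) * sin p) * sin lam, (M p + h) * cos p] p := by
    refine EuclideanSpace.hasDerivAt_of_apply fun i => ?_
    simp only [hr]
    fin_cases i
    · exact (hparallel p).mul_const _
    · exact (hparallel p).mul_const _
    · exact haxial p
  have hr2 := (((hdM φ).add_const h).mul (hasDerivAt_sin φ)).neg
  have hr3 := ((hdM φ).add_const h).mul (hasDerivAt_cos φ)
  have hr4 := EuclideanSpace.hasDerivAt_of_apply (x := φ)
    (f := fun p => !₂[-((M p + h) * sin p) * cos lam, -((M p + h) * sin p) * sin lam,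
      (M p + h) * cos p]) (f' := !₂[_, _, _]) fun i => by
    fin_cases i
    · exact hr2.mul_const (cos lam)
    · exact hr2.mul_const (sin lam)
    · exact hr3
  rw [funext fun p => (hr1 p).deriv, hr4.deriv]
  have htrig : 3 * N φ * e ^ 2 * (1 - e ^ 2) * (M φ + h) * sin φ * cos φ /
      (1 - e ^ 2 * sin φ ^ 2) ^ 2 = 3 * N φ * e ^ 2 * (1 - e ^ 2) * sin φ * cos φ /
      (1 - e ^ 2 * sin φ ^ 2) ^ 2 * (M φ + h) := by ring
  rw [htrig]
  generalize 3 * N φ * e ^ 2 * (1 - e ^ 2) * sin φ * cos φ /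
    (1 - e ^ 2 * sin φ ^ 2) ^ 2 = m'
  simp [PiLp.inner_apply, Fin.sum_univ_three]
  have h1 := sin_sq_add_cos_sq φ
  have h2 := sin_sq_add_cos_sq lam
  linear_combination (M φ + h) * sin φ * (m' * sin φ + (M φ + h) * cos φ) * h2 +
    m' * (M φ + h) * h1
end

section
/- Fix reals ρ_e > 0, e ∈ [0,1), h ≥ 0. Define N(φ) = ρ_e/√(1 − e²·sin²φ). Then for every φ ∈ (−π/2, π/2), the function φ ↦ log[(N(φ)+h)·cos φ] is differentiable at φ with derivative equal to −sin φ·[h·(1 − e²·sin²φ) + N(φ)·(1−e²)] / ((N(φ)+h)·(1 − e²·sin²φ)·cos φ). -/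
open Real

theorem one_sub_sq_mul_sin_sq_pos {e : ℝ} (he0 : 0 ≤ e) (he1 : e < 1) (φ : ℝ) :
    0 < 1 - e ^ 2 * Real.sin φ ^ 2 := by
  nlinarith [mul_le_mul_of_nonneg_left (Real.sin_sq_le_one φ) (sq_nonneg e)]

theorem hasDerivAt_div_sqrt_one_sub_sq_mul_sin_sq (a e φ : ℝ)
    (hW : 0 < 1 - e ^ 2 * Real.sin φ ^ 2) :
    HasDerivAt (fun x => a / Real.sqrt (1 - e ^ 2 * Real.sin x ^ 2))
      (a / Real.sqrt (1 - e ^ 2 * Real.sin φ ^ 2) * (e ^ 2 * Real.sin φ * Real.cos φ) /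
        (1 - e ^ 2 * Real.sin φ ^ 2)) φ := by
  have hS := Real.sqrt_pos.2 hW
  have hd : HasDerivAt (fun x => 1 - e ^ 2 * Real.sin x ^ 2)
      (-(e ^ 2 * (2 * Real.sin φ * Real.cos φ))) φ := by
    simpa using (((Real.hasDerivAt_sin φ).pow 2).const_mul (e ^ 2)).const_sub 1
  refine ((hasDerivAt_const φ a).fun_div (hd.sqrt hW.ne') hS.ne').congr_deriv ?_
  rw [Real.sq_sqrt hW.le]
  field_simp
  ring

/-- The derivative of `log[(N(φ)+h)·cos φ]` is (minus) the Christoffel symbol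
`Γ^λ_{φλ}` of the surface of constant altitude `h`. -/
theorem hasDerivAt_log_N_cos
    (ρe e h : ℝ) (hρe : 0 < ρe) (he0 : 0 ≤ e) (he1 : e < 1) (hh : 0 ≤ h)
    (N : ℝ → ℝ)
    (hN : ∀ φ : ℝ, N φ = ρe / Real.sqrt (1 - e ^ 2 * Real.sin φ ^ 2))
    (φ : ℝ) (hφ : φ ∈ Set.Ioo (-(Real.pi / 2)) (Real.pi / 2)) :
    HasDerivAt (fun x => Real.log ((N x + h) * Real.cos x))
      (-Real.sin φ * (h * (1 - e ^ 2 * Real.sin φ ^ 2) + N φ * (1 - e ^ 2)) /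
        ((N φ + h) * (1 - e ^ 2 * Real.sin φ ^ 2) * Real.cos φ)) φ := by
  have hW := one_sub_sq_mul_sin_sq_pos he0 he1 φ
  have hc : 0 < Real.cos φ := Real.cos_pos_of_mem_Ioo hφ
  have hN' := hasDerivAt_div_sqrt_one_sub_sq_mul_sin_sq ρe e φ hW
  rw [← hN φ, ← funext hN] at hN'
  have hNh : 0 < N φ + h := by
    have : 0 < N φ := hN φ ▸ div_pos hρe (Real.sqrt_pos.2 hW)
    positivity
  refine (((hN'.add_const h).fun_mul (Real.hasDerivAt_cos φ)).log
    (mul_pos hNh hc).ne').congr_deriv ?_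
  rw [div_eq_div_iff (by positivity) (by positivity)]
  field_simp
  linear_combination (N φ * e ^ 2 * Real.sin φ) * Real.sin_sq_add_cos_sq φ
end

section
/- Fix reals ρ_e > 0, e ∈ [0,1), h ≥ 0, and constants c₃, c₅ ∈ ℝ. Define N(τ) = ρ_e/√(1 − e²·τ²), D(τ) = h·(1−e²τ²) + N(τ)·(1−e²), and P(τ) = [ c₅·(1−τ²) − c₃²/(N(τ)+h)² ] · (1−e²τ²)² / D(τ)². Then for every τ with 1 − τ² > 0 and 1 − e²·τ² > 0, P is differentiable at τ and satisfies (1/2)·(1−τ²)·P'(τ) + τ·( [h·(1−e²τ²)² + N(τ)·(1−e²)·(1 + 3e² − 4e²τ²)] / [D(τ)·(1−e²τ²)] )·P(τ) + τ·c₃²·(1−e²τ²) / ( (N(τ)+h)³·D(τ) ) = 0. -/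
/-- The derivative of the transverse radius of curvature with respect to the sine of the latitude. -/
theorem hasDerivAt_transverse_radius (ρ e τ : ℝ) (hτ : 0 < 1 - e ^ 2 * τ ^ 2) :
    HasDerivAt (fun t : ℝ => ρ / √(1 - e ^ 2 * t ^ 2))
      (ρ / √(1 - e ^ 2 * τ ^ 2) * (e ^ 2 * τ) / (1 - e ^ 2 * τ ^ 2)) τ := by
  have hs : 0 < √(1 - e ^ 2 * τ ^ 2) := Real.sqrt_pos.2 hτ
  have hw : HasDerivAt (fun t : ℝ => 1 - e ^ 2 * t ^ 2) (-(2 * e ^ 2 * τ)) τ := by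
    refine (((hasDerivAt_id τ).pow 2).const_mul (e ^ 2)).const_sub 1 |>.congr_deriv ?_
    simp
    ring
  refine ((hasDerivAt_const τ ρ).div (hw.sqrt hτ.ne') hs.ne').congr_deriv ?_
  rw [Real.sq_sqrt hτ.le]
  field_simp
  ring

/-- The general solution `P(τ)` obtained by variation of constants satisfies the
linear first-order differential equation for `P = (dτ/ds)²` along geodesics of
the surface at constant altitude `h`. -/
theorem variation_of_constants_solution_satisfies_ODE
    (ρe e h c₃ c₅ : ℝ) (hρe : 0 < ρe) (he0 : 0 ≤ e) (he1 : e < 1) (hh : 0 ≤ h)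
    (N D P : ℝ → ℝ)
    (hN : ∀ τ : ℝ, N τ = ρe / Real.sqrt (1 - e ^ 2 * τ ^ 2))
    (hD : ∀ τ : ℝ, D τ = h * (1 - e ^ 2 * τ ^ 2) + N τ * (1 - e ^ 2))
    (hP : ∀ τ : ℝ, P τ =
      (c₅ * (1 - τ ^ 2) - c₃ ^ 2 / (N τ + h) ^ 2) * (1 - e ^ 2 * τ ^ 2) ^ 2 / D τ ^ 2)
    (τ : ℝ) (hτ1 : 0 < 1 - τ ^ 2) (hτ2 : 0 < 1 - e ^ 2 * τ ^ 2) :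
    DifferentiableAt ℝ P τ ∧
      (1 / 2) * (1 - τ ^ 2) * deriv P τ +
        τ * ((h * (1 - e ^ 2 * τ ^ 2) ^ 2 +
            N τ * (1 - e ^ 2) * (1 + 3 * e ^ 2 - 4 * e ^ 2 * τ ^ 2)) /
          (D τ * (1 - e ^ 2 * τ ^ 2))) * P τ +
        τ * c₃ ^ 2 * (1 - e ^ 2 * τ ^ 2) / ((N τ + h) ^ 3 * D τ) = 0 := by
  have hn : 0 < N τ := hN τ ▸ div_pos hρe (Real.sqrt_pos.2 hτ2)
  have he : 0 < 1 - e ^ 2 := by nlinarith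
  have hd : 0 < D τ := by rw [hD]; positivity
  have hnh : 0 < N τ + h := by positivity
  have hN' : HasDerivAt N (N τ * (e ^ 2 * τ) / (1 - e ^ 2 * τ ^ 2)) τ := by
    rw [funext hN]
    exact hasDerivAt_transverse_radius ρe e τ hτ2
  have hsq : HasDerivAt (fun t : ℝ => t ^ 2) (2 * τ) τ := by
    simpa using hasDerivAt_pow 2 τ
  have hw : HasDerivAt (fun t : ℝ => 1 - e ^ 2 * t ^ 2) (-(e ^ 2 * (2 * τ))) τ :=
    (hsq.const_mul (e ^ 2)).const_sub 1
  have hD' : HasDerivAt D (h * -(e ^ 2 * (2 * τ)) +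
      N τ * (e ^ 2 * τ) / (1 - e ^ 2 * τ ^ 2) * (1 - e ^ 2)) τ := by
    rw [funext hD]
    exact (hw.const_mul h).add (hN'.mul_const (1 - e ^ 2))
  have hP' := ((((hsq.const_sub 1).const_mul c₅).sub
    ((hasDerivAt_const τ (c₃ ^ 2)).div ((hN'.add_const h).pow 2) (pow_pos hnh 2).ne')).mul
      (hw.pow 2)).div (hD'.pow 2) (pow_pos hd 2).ne'
  replace hP' := hP'.congr_of_eventuallyEq (f₁ := P) (.of_forall hP)
  refine ⟨hP'.differentiableAt, ?_⟩
  rw [hP'.deriv, hP]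
  simp only [Pi.pow_apply, Pi.mul_apply, Pi.sub_apply, Pi.div_apply, Nat.cast_ofNat, Nat.add_one_sub_one, pow_one]
  have hDτ := hD τ
  generalize N τ = n at hDτ hnh ⊢
  generalize D τ = d at hDτ hd ⊢
  generalize hwτ : 1 - e ^ 2 * τ ^ 2 = w at hDτ hτ2 ⊢
  field_simp
  subst hDτ hwτ
  ring
end

section
/- Fix reals ρ_e > 0, e ∈ [0,1), h ≥ 0, c₃ ∈ ℝ, and define N(φ) = ρ_e/√(1 − e²·sin²φ), M(φ) = ρ_e·(1−e²)/(1 − e²·sin²φ)^{3/2}, E(φ) = (N(φ)+h)²·cos²φ, G(φ) = (M(φ)+h)². Let φ, λ ∈ ℝ and u, v ∈ ℝ be such that cos φ ≠ 0, E(φ)·u² + G(φ)·v² = 1, and u = c₃/E(φ). Then ( (M(φ)+h)·cos φ·v )² = 1 − sin²φ − c₃²/(N(φ)+h)². -/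
open Real

/-- Reduction of the arclength normalization and the Clairaut first integral to
the equation `(dτ/ds)² = [1 − τ² − c₃²/(N+h)²]/(M+h)²` for `τ = sin φ`. -/
theorem reduced_latitude_equation
    (ρe e h c₃ : ℝ) (hρe : 0 < ρe) (he0 : 0 ≤ e) (he1 : e < 1) (hh : 0 ≤ h)
    (N M E G : ℝ → ℝ)
    (hN : ∀ φ : ℝ, N φ = ρe / Real.sqrt (1 - e ^ 2 * Real.sin φ ^ 2))
    (hM : ∀ φ : ℝ, M φ = ρe * (1 - e ^ 2) / (1 - e ^ 2 * Real.sin φ ^ 2) ^ ((3 : ℝ) / 2))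
    (hE : ∀ φ : ℝ, E φ = (N φ + h) ^ 2 * Real.cos φ ^ 2)
    (hG : ∀ φ : ℝ, G φ = (M φ + h) ^ 2)
    (φ lam u v : ℝ) (hcos : Real.cos φ ≠ 0)
    (hnorm : E φ * u ^ 2 + G φ * v ^ 2 = 1)
    (hu : u = c₃ / E φ) :
    ((M φ + h) * Real.cos φ * v) ^ 2 =
      1 - Real.sin φ ^ 2 - c₃ ^ 2 / (N φ + h) ^ 2 := by
  have hpos : 0 < 1 - e ^ 2 * Real.sin φ ^ 2 := by
    nlinarith [Real.sin_sq_le_one φ, sq_nonneg e, sq_nonneg (Real.sin φ)]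
  have hNh : N φ + h ≠ 0 := by
    rw [hN]
    positivity
  rw [hu, hE, hG] at hnorm
  have hclairaut : (N φ + h) ^ 2 * cos φ ^ 2 * (c₃ / ((N φ + h) ^ 2 * cos φ ^ 2)) ^ 2 *
      cos φ ^ 2 = c₃ ^ 2 / (N φ + h) ^ 2 := by
    field_simp
  linear_combination cos φ ^ 2 * hnorm - hclairaut + Real.sin_sq_add_cos_sq φ
end

section
/- Fix reals ρ_e > 0, e ∈ [0,1), h, c₃ ∈ ℝ. Let u ∈ ℝ satisfy 1 − e²·u > 0 and (1 − u)·( ρ_e/√(1 − e²·u) + h )² = c₃². Then u is a root of the quartic polynomial: e⁴h⁴·u⁴ + 2e²h²·[ρ_e² − h² + e²·(c₃² − h²)]·u³ + [ (ρ_e² − h²)² + 2e²·(2h⁴ − 2c₃²h² − 2ρ_e²h² − ρ_e²c₃²) + e⁴·(c₃² − h²)² ]·u² + 2·[ −(ρ_e² − h²)² + c₃²·(ρ_e² + h²) + e²·( −(c₃² − h²)² + ρ_e²·(c₃² + h²) ) ]·u + [ (ρ_e + h)² − c₃² ]·[ (ρ_e − h)² − c₃² ] = 0. -/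
open Real

/-- The squared sine `u = τ_m²` of the latitude of closest polar approach, defined
by `(1 − u)·(N(√u)+h)² = c₃²`, is a root of an explicit quartic polynomial. -/
theorem closest_polar_approach_quartic
    (ρe e h c₃ : ℝ) (hρe : 0 < ρe) (he0 : 0 ≤ e) (he1 : e < 1)
    (u : ℝ) (hu1 : 0 < 1 - e ^ 2 * u)
    (hu2 : (1 - u) * (ρe / Real.sqrt (1 - e ^ 2 * u) + h) ^ 2 = c₃ ^ 2) :
    e ^ 4 * h ^ 4 * u ^ 4 +
      2 * e ^ 2 * h ^ 2 * (ρe ^ 2 - h ^ 2 + e ^ 2 * (c₃ ^ 2 - h ^ 2)) * u ^ 3 +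
      ((ρe ^ 2 - h ^ 2) ^ 2 +
        2 * e ^ 2 * (2 * h ^ 4 - 2 * c₃ ^ 2 * h ^ 2 - 2 * ρe ^ 2 * h ^ 2 - ρe ^ 2 * c₃ ^ 2) +
        e ^ 4 * (c₃ ^ 2 - h ^ 2) ^ 2) * u ^ 2 +
      2 * (-(ρe ^ 2 - h ^ 2) ^ 2 + c₃ ^ 2 * (ρe ^ 2 + h ^ 2) +
        e ^ 2 * (-(c₃ ^ 2 - h ^ 2) ^ 2 + ρe ^ 2 * (c₃ ^ 2 + h ^ 2))) * u +
      ((ρe + h) ^ 2 - c₃ ^ 2) * ((ρe - h) ^ 2 - c₃ ^ 2) = 0 := by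
  set s := Real.sqrt (1 - e ^ 2 * u)
  have hs0 : s ≠ 0 := (Real.sqrt_pos.mpr hu1).ne'
  have hsq : s ^ 2 = 1 - e ^ 2 * u := Real.sq_sqrt hu1.le
  have hclear : (1 - u) * (ρe + h * s) ^ 2 = c₃ ^ 2 * s ^ 2 := by
    rw [← hu2]
    field_simp
  have hodd : (1 - u) * (ρe ^ 2 + h ^ 2 * s ^ 2) - c₃ ^ 2 * s ^ 2
      = -(2 * (1 - u) * ρe * h * s) := by
    linear_combination hclear
  have hsquared : ((1 - u) * (ρe ^ 2 + h ^ 2 * s ^ 2) - c₃ ^ 2 * s ^ 2) ^ 2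
      = 4 * (1 - u) ^ 2 * ρe ^ 2 * h ^ 2 * s ^ 2 := by
    rw [hodd]
    ring
  rw [hsq] at hsquared
  linear_combination hsquared
end

section
/- Fix reals ρ_e > 0, e ∈ [0,1), h ≥ 0, c₃ ∈ ℝ, and define N(φ) = ρ_e/√(1 − e²·sin²φ), M(φ) = ρ_e·(1−e²)/(1 − e²·sin²φ)^{3/2}, E(φ) = (N(φ)+h)²·cos²φ, G(φ) = (M(φ)+h)². Let φ ∈ ℝ and u, v ∈ ℝ satisfy cos φ > 0, E(φ)·u² + G(φ)·v² = 1, u = c₃/E(φ), and v ≠ 0. Then the tangent of the nautical course, tan κ = √(E(φ))·u / ( √(G(φ))·v ), satisfies tan κ = sgn(v)·c₃ / ( (N(φ)+h)·√( cos²φ − c₃²/(N(φ)+h)² ) ). -/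
open Real

/-- The tangent of the nautical course along an arclength-parametrized geodesic
with Clairaut constant `c₃` satisfies
`tan κ = sgn(v)·c₃/((N+h)·√(cos²φ − c₃²/(N+h)²))`. -/
theorem nautical_course_tangent
    (ρe e h c₃ : ℝ) (hρe : 0 < ρe) (he0 : 0 ≤ e) (he1 : e < 1) (hh : 0 ≤ h)
    (N M E G : ℝ → ℝ)
    (hN : ∀ φ : ℝ, N φ = ρe / Real.sqrt (1 - e ^ 2 * Real.sin φ ^ 2))
    (hM : ∀ φ : ℝ, M φ = ρe * (1 - e ^ 2) / (1 - e ^ 2 * Real.sin φ ^ 2) ^ ((3 : ℝ) / 2))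
    (hE : ∀ φ : ℝ, E φ = (N φ + h) ^ 2 * Real.cos φ ^ 2)
    (hG : ∀ φ : ℝ, G φ = (M φ + h) ^ 2)
    (φ u v : ℝ) (hcos : 0 < Real.cos φ)
    (hnorm : E φ * u ^ 2 + G φ * v ^ 2 = 1)
    (hu : u = c₃ / E φ) (hv : v ≠ 0)
    (κ : ℝ)
    (hκ : Real.tan κ = Real.sqrt (E φ) * u / (Real.sqrt (G φ) * v)) :
    Real.tan κ =
      Real.sign v * c₃ /
        ((N φ + h) * Real.sqrt (Real.cos φ ^ 2 - c₃ ^ 2 / (N φ + h) ^ 2)) := by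
  have hs : e ^ 2 * Real.sin φ ^ 2 < 1 := by
    have h1 : e ^ 2 < 1 := by nlinarith
    nlinarith [Real.sin_sq_le_one φ, sq_nonneg e]
  have hd : 0 < 1 - e ^ 2 * Real.sin φ ^ 2 := by linarith
  have hp : 0 < N φ + h := by
    rw [hN]
    positivity
  have hq : 0 < M φ + h := by
    rw [hM]
    have : 0 < 1 - e ^ 2 := by nlinarith
    positivity
  have hpc : 0 < (N φ + h) * Real.cos φ := mul_pos hp hcos
  rw [hE] at hu
  rw [hE, hG, hu] at hnorm
  rw [hκ, hE, hG, hu, ← mul_pow, Real.sqrt_sq hpc.le, Real.sqrt_sq hq.le]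
  generalize N φ + h = p at *
  generalize M φ + h = q at *
  generalize Real.cos φ = c at *
  have hrad : c ^ 2 - c₃ ^ 2 / p ^ 2 = (c * q * |v|) ^ 2 := by
    rw [mul_pow, sq_abs]
    field_simp at hnorm ⊢
    linear_combination -hnorm
  rw [hrad, Real.sqrt_sq (by positivity)]
  rcases lt_or_gt_of_ne hv with hv' | hv'
  · rw [Real.sign_of_neg hv', abs_of_neg hv']
    field_simp
  · rw [Real.sign_of_pos hv', abs_of_pos hv']
    field_simp
end
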